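/- arXiv:1808.03146 — 4 statements merged into one kernel-verified Lean document; each statement's English description precedes it below -/
import Mathlib

section
/- Let L be a field, V and V' finite-dimensional L-vector spaces, and φ : V → V, φ' : V' → V' L-linear endomorphisms such that the characteristic polynomial of φ and the characteristic polynomial of φ' are coprime in L[X]. Then every L-linear map f : V → V' satisfying f ∘ φ = φ' ∘ f is the zero map. -/
open Polynomial in
/-- A linear map intertwining two endomorphisms intertwines every polynomial in them. -/
theorem LinearMap.comp_aeval_of_comp_eq {R M N : Type*} [CommSemiring R]
    [AddCommMonoid M] [Module R M] [AddCommMonoid N] [Module R N]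
    {φ : Module.End R M} {ψ : Module.End R N} {f : M →ₗ[R] N}
    (hf : f ∘ₗ φ = ψ ∘ₗ f) (p : R[X]) :
    f ∘ₗ aeval φ p = aeval ψ p ∘ₗ f := by
  induction p using Polynomial.induction_on' with
  | add p q hp hq => rw [map_add, map_add, LinearMap.comp_add, LinearMap.add_comp, hp, hq]
  | monomial n a =>
    ext x
    have h := LinearMap.congr_fun (Module.End.commute_pow_left_of_commute hf.symm n) x
    simp only [LinearMap.comp_apply] at h
    simp [aeval_monomial, Module.algebraMap_end_apply, h]

/-- If the characteristic polynomials of two endomorphisms are coprime, then every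
linear map intertwining them is zero. -/
theorem no_nonzero_maps_between_coprime_charpoly
    {L V V' : Type*} [Field L]
    [AddCommGroup V] [Module L V] [FiniteDimensional L V]
    [AddCommGroup V'] [Module L V'] [FiniteDimensional L V']
    (φ : V →ₗ[L] V) (φ' : V' →ₗ[L] V')
    (hcop : IsCoprime (LinearMap.charpoly φ) (LinearMap.charpoly φ'))
    (f : V →ₗ[L] V') (hf : f ∘ₗ φ = φ' ∘ₗ f) :
    f = 0 := by
  obtain ⟨a, b, hab⟩ := hcop
  have h₁ : Polynomial.aeval φ (b * φ'.charpoly) = 1 := by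
    have h := congrArg (Polynomial.aeval φ) hab
    rwa [map_add, map_mul, φ.aeval_self_charpoly, mul_zero, zero_add, map_one] at h
  have h₂ : Polynomial.aeval φ' (b * φ'.charpoly) = 0 := by
    rw [map_mul, φ'.aeval_self_charpoly, mul_zero]
  have h := LinearMap.comp_aeval_of_comp_eq hf (b * φ'.charpoly)
  rwa [h₁, h₂, LinearMap.zero_comp, Module.End.one_eq_id, LinearMap.comp_id] at h
end

section
/- Let L be a field, V a finite-dimensional L-vector space, φ : V → V an L-linear endomorphism, and W ⊆ V a φ-invariant subspace. Assume the characteristic polynomial of the restriction of φ to W is coprime in L[X] to the characteristic polynomial of the endomorphism induced by φ on the quotient V/W. Then there exists a unique φ-invariant subspace U ⊆ V with W ⊓ U = ⊥ and W ⊔ U = ⊤, i.e. W admits a unique φ-invariant complement. -/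
open Polynomial in
/-- A linear map intertwining two endomorphisms intertwines all polynomials in them. -/
theorem LinearMap.map_aeval_of_intertwines {R M N : Type*} [CommRing R]
    [AddCommGroup M] [Module R M] [AddCommGroup N] [Module R N]
    {f : Module.End R M} {f' : Module.End R N} {g : M →ₗ[R] N}
    (h : ∀ x, g (f x) = f' (g x)) (p : R[X]) (x : M) :
    g (aeval f p x) = aeval f' p (g x) := by
  induction p using Polynomial.induction_on' generalizing x with
  | add p q hp hq => simp [hp, hq]
  | monomial n a =>
    have key : ∀ y, g ((f ^ n) y) = (f' ^ n) (g y) := by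
      induction n with
      | zero => simp
      | succ n ih => intro y; simp [pow_succ, ih, h]
    simp [aeval_monomial, Module.algebraMap_end_apply, key]

open Polynomial in
theorem Submodule.aeval_apply_mem_of_invariant {R M : Type*} [CommRing R]
    [AddCommGroup M] [Module R M] {f : Module.End R M} {U : Submodule R M}
    (hU : ∀ x ∈ U, f x ∈ U) (p : R[X]) {x : M} (hx : x ∈ U) :
    aeval f p x ∈ U := by
  have h := LinearMap.map_aeval_of_intertwines (f := LinearMap.restrict f hU) (f' := f)
    (g := U.subtype) (fun _ => rfl) p ⟨x, hx⟩
  exact h ▸ Subtype.property _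

/-- If the characteristic polynomials of the restriction of `φ` to an invariant subspace `W`
and of the induced endomorphism on the quotient `V ⧸ W` are coprime, then `W` admits a
unique `φ`-invariant complement. -/
theorem unique_invariant_complement_of_coprime_charpoly
    {L V : Type*} [Field L] [AddCommGroup V] [Module L V] [FiniteDimensional L V]
    (φ : V →ₗ[L] V) (W : Submodule L V) (hW : ∀ x ∈ W, φ x ∈ W)
    (hcop : IsCoprime (LinearMap.charpoly (φ.restrict hW))
      (LinearMap.charpoly (Submodule.mapQ W W φ (fun x hx => hW x hx)))) :
    ∃! U : Submodule L V, (∀ x ∈ U, φ x ∈ U) ∧ IsCompl W U := by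
  have hp : ∀ x ∈ W, Polynomial.aeval φ (φ.restrict hW).charpoly x = 0 := by
    intro x hx
    have h := LinearMap.map_aeval_of_intertwines (f := φ.restrict hW) (f' := φ)
      (g := W.subtype) (fun _ => rfl) (φ.restrict hW).charpoly ⟨x, hx⟩
    rw [LinearMap.aeval_self_charpoly] at h
    simpa using h.symm
  have hq : ∀ x, Polynomial.aeval φ
      (Submodule.mapQ W W φ (fun x hx => hW x hx)).charpoly x ∈ W := by
    intro x
    have h := LinearMap.map_aeval_of_intertwines (f := φ)
      (f' := Submodule.mapQ W W φ (fun x hx => hW x hx))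
      (g := W.mkQ) (fun _ => rfl) (Submodule.mapQ W W φ (fun x hx => hW x hx)).charpoly x
    rw [LinearMap.aeval_self_charpoly] at h
    simpa using h
  generalize (φ.restrict hW).charpoly = p at hcop hp
  generalize (Submodule.mapQ W W φ (fun x hx => hW x hx)).charpoly = q at hcop hq
  have hcompl : IsCompl W (LinearMap.ker (Polynomial.aeval φ q)) := by
    refine ⟨(Polynomial.disjoint_ker_aeval_of_isCoprime φ hcop).mono_left hp, ?_⟩
    rw [codisjoint_iff, eq_top_iff, ← Polynomial.sup_aeval_range_eq_top_of_isCoprime φ hcop,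
      sup_comm]
    refine sup_le_sup ?_ ?_
    · rintro _ ⟨x, rfl⟩
      exact hq x
    · rintro _ ⟨x, rfl⟩
      rw [LinearMap.mem_ker, ← Module.End.mul_apply, ← map_mul, mul_comm, map_mul,
        Module.End.mul_apply]
      exact hp _ (hq x)
  refine ⟨LinearMap.ker (Polynomial.aeval φ q), ⟨fun x hx => ?_, hcompl⟩, ?_⟩
  · rw [LinearMap.mem_ker] at hx ⊢
    rw [← LinearMap.map_aeval_of_intertwines (f := φ) (g := φ) (fun _ => rfl), hx, map_zero]
  · rintro U ⟨hU, hWU⟩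
    have hle : U ≤ LinearMap.ker (Polynomial.aeval φ q) := fun x hx =>
      Submodule.disjoint_def.mp hWU.disjoint _ (hq x)
        (Submodule.aeval_apply_mem_of_invariant hU q hx)
    refine eq_of_le_of_inf_le_of_sup_le (z := W) hle ?_ ?_
    · rw [hcompl.symm.inf_eq_bot]
      exact bot_le
    · rw [hWU.symm.sup_eq_top]
      exact le_top
end

section
/- Let L be a field, V a finite-dimensional L-vector space, φ : V → V an L-linear endomorphism, and ⊥ = W_{-1} ≤ W_0 ≤ W_1 ≤ ⋯ ≤ W_n = ⊤ a chain of φ-invariant subspaces of V. Let P_i ∈ L[X] be the characteristic polynomial of the endomorphism induced by φ on W_i/W_{i-1}, and assume the P_i are pairwise coprime in L[X]. Then there exists a unique family (U_0, …, U_n) of φ-invariant subspaces of V such that for every k the subspaces U_0, …, U_k are independent and W_k = U_0 ⊔ U_1 ⊔ ⋯ ⊔ U_k. In particular the filtration (W_k) splits canonically. -/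
/-- The endomorphism induced by `φ` on the graded piece `B ⧸ A` of a pair of nested
`φ`-invariant subspaces `A ≤ B`. -/
noncomputable def gradedEnd {L V : Type*} [Field L] [AddCommGroup V] [Module L V]
    (φ : V →ₗ[L] V) (A B : Submodule L V)
    (hA : ∀ x ∈ A, φ x ∈ A) (hB : ∀ x ∈ B, φ x ∈ B) :
    (B ⧸ A.comap B.subtype) →ₗ[L] (B ⧸ A.comap B.subtype) :=
  Submodule.mapQ _ _ (φ.restrict hB) (fun x hx => hA x.1 hx)

/-- The characteristic polynomial of the endomorphism induced by `φ` on the graded piece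
`B ⧸ A` of a pair of nested `φ`-invariant subspaces `A ≤ B`. -/
noncomputable def gradedCharpoly {L V : Type*} [Field L] [AddCommGroup V] [Module L V]
    [FiniteDimensional L V] (φ : V →ₗ[L] V) (A B : Submodule L V)
    (hA : ∀ x ∈ A, φ x ∈ A) (hB : ∀ x ∈ B, φ x ∈ B) : Polynomial L :=
  LinearMap.charpoly (gradedEnd φ A B hA hB)

open Polynomial in
theorem Polynomial.aeval_apply_mem_of_invariant {L V : Type*} [CommSemiring L] [AddCommMonoid V]
    [Module L V] {φ : V →ₗ[L] V} {A : Submodule L V} (hA : ∀ x ∈ A, φ x ∈ A) (p : L[X]) :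
    ∀ x ∈ A, aeval φ p x ∈ A := by
  induction p using Polynomial.induction_on' with
  | add p q hp hq =>
    intro x hx
    simpa using A.add_mem (hp x hx) (hq x hx)
  | monomial n a =>
    intro x hx
    rw [aeval_monomial, Module.End.mul_apply, Module.algebraMap_end_apply]
    refine A.smul_mem a ?_
    induction n with
    | zero => simpa using hx
    | succ n ih =>
      rw [pow_succ', Module.End.mul_apply]
      exact hA _ ih

open Polynomial in
theorem aeval_comp_of_comp_eq {L V V' : Type*} [CommSemiring L] [AddCommMonoid V] [Module L V]
    [AddCommMonoid V'] [Module L V'] {φ : V →ₗ[L] V} {ψ : V' →ₗ[L] V'} {f : V →ₗ[L] V'}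
    (h : ∀ x, f (φ x) = ψ (f x)) (p : L[X]) (x : V) :
    f (aeval φ p x) = aeval ψ p (f x) := by
  induction p using Polynomial.induction_on' with
  | add p q hp hq => simp [hp, hq]
  | monomial n a =>
    simp only [aeval_monomial, Module.End.mul_apply, Module.algebraMap_end_apply, map_smul]
    congr 1
    induction n with
    | zero => simp
    | succ n ih => rw [pow_succ', pow_succ', Module.End.mul_apply, Module.End.mul_apply, h, ih]

/-- By Cayley-Hamilton on the graded piece, the graded characteristic polynomial evaluated at `φ`
maps the larger subspace into the smaller one. -/
theorem aeval_gradedCharpoly_apply_mem {L V : Type*} [Field L] [AddCommGroup V] [Module L V]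
    [FiniteDimensional L V] {φ : V →ₗ[L] V} {A B : Submodule L V}
    (hA : ∀ x ∈ A, φ x ∈ A) (hB : ∀ x ∈ B, φ x ∈ B) {x : V} (hx : x ∈ B) :
    Polynomial.aeval φ (gradedCharpoly φ A B hA hB) x ∈ A := by
  set p := gradedCharpoly φ A B hA hB with hp
  have hsub := aeval_comp_of_comp_eq (φ := φ.restrict hB) (ψ := φ) (f := B.subtype)
    (fun _ => rfl) p ⟨x, hx⟩
  have hquot := aeval_comp_of_comp_eq (φ := φ.restrict hB) (ψ := gradedEnd φ A B hA hB)
    (f := (A.comap B.subtype).mkQ) (fun _ => rfl) p ⟨x, hx⟩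
  rw [hp, gradedCharpoly, LinearMap.aeval_self_charpoly, LinearMap.zero_apply,
    Submodule.mkQ_apply, Submodule.Quotient.mk_eq_zero, Submodule.mem_comap] at hquot
  rw [← gradedCharpoly, ← hp, hsub] at hquot
  exact hquot

open Polynomial in
theorem mem_of_aeval_apply_eq_zero_of_isCoprime {L V : Type*} [CommRing L] [AddCommGroup V]
    [Module L V] {φ : V →ₗ[L] V} {A : Submodule L V} (hA : ∀ x ∈ A, φ x ∈ A) {p q : L[X]}
    (hpq : IsCoprime p q) {x : V} (hp : aeval φ p x = 0) (hq : aeval φ q x ∈ A) : x ∈ A := by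
  obtain ⟨a, b, hab⟩ := hpq
  have h : aeval φ a (aeval φ p x) + aeval φ b (aeval φ q x) = x := by
    simpa using congrArg (fun r => aeval φ r x) hab
  rw [← h, hp, map_zero, zero_add]
  exact aeval_apply_mem_of_invariant hA b _ hq

open Polynomial in
theorem iSup_ker_aeval_le_ker_aeval_prod {L V ι : Type*} [CommRing L] [AddCommGroup V]
    [Module L V] (φ : V →ₗ[L] V) (p : ι → L[X]) (s : Finset ι) :
    ⨆ i ∈ s, LinearMap.ker (aeval φ (p i)) ≤ LinearMap.ker (aeval φ (∏ i ∈ s, p i)) := by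
  refine iSup₂_le fun i hi x hx => ?_
  obtain ⟨q, hq⟩ := Finset.dvd_prod_of_mem p hi
  rw [LinearMap.mem_ker] at hx ⊢
  rw [hq, mul_comm, map_mul, Module.End.mul_apply, hx, map_zero]

open Polynomial in
theorem iSupIndep_ker_aeval_of_pairwise_isCoprime {L V ι : Type*} [CommRing L] [AddCommGroup V]
    [Module L V] [Fintype ι] (φ : V →ₗ[L] V) {p : ι → L[X]}
    (hp : Pairwise fun i j => IsCoprime (p i) (p j)) :
    iSupIndep fun i => LinearMap.ker (aeval φ (p i)) := by
  classical
  intro i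
  have hcop : IsCoprime (p i) (∏ j ∈ Finset.univ.erase i, p j) :=
    IsCoprime.prod_right fun j hj => hp (Finset.ne_of_mem_erase hj).symm
  refine (disjoint_ker_aeval_of_isCoprime φ hcop).mono_right ?_
  simpa using iSup_ker_aeval_le_ker_aeval_prod φ p (Finset.univ.erase i)

open Polynomial in
theorem le_iSup_ker_aeval_of_filtration {L V : Type*} [CommRing L] [AddCommGroup V]
    [Module L V] {φ : V →ₗ[L] V} {W : ℕ → Submodule L V} {P : ℕ → L[X]} (hbot : W 0 = ⊥) (m : ℕ)
    (hW : ∀ k < m, ∀ x ∈ W (k + 1), aeval φ (P k) x ∈ W k)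
    (hcop : ∀ k < m, ∀ j < m, k ≠ j → IsCoprime (P k) (P j)) :
    W m ≤ ⨆ i : Fin m, LinearMap.ker (aeval φ (P i)) := by
  have hprod : ∀ k ≤ m, ∀ x ∈ W k, aeval φ (∏ i ∈ Finset.range k, P i) x = 0 := by
    intro k
    induction k with
    | zero =>
      intro _ x hx
      simpa [hbot] using hx
    | succ k ih =>
      intro hk x hx
      rw [Finset.prod_range_succ, map_mul, Module.End.mul_apply]
      exact ih (by lia) _ (hW k hk x hx)
  have hker : ∀ k ≤ m, LinearMap.ker (aeval φ (∏ i ∈ Finset.range k, P i)) ≤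
      ⨆ i : Fin m, LinearMap.ker (aeval φ (P i)) := by
    intro k
    induction k with
    | zero => simp [Module.End.one_eq_id]
    | succ k ih =>
      intro hk
      have hc : IsCoprime (∏ i ∈ Finset.range k, P i) (P k) :=
        IsCoprime.prod_left fun i hi => by
          have := Finset.mem_range.mp hi
          exact hcop i (by lia) k hk (by lia)
      rw [Finset.prod_range_succ, ← sup_ker_aeval_eq_ker_aeval_mul_of_coprime φ hc]
      exact sup_le (ih (by lia))
        (le_iSup (fun i : Fin m => LinearMap.ker (aeval φ (P i))) ⟨k, hk⟩)
  exact fun x hx => hker m le_rfl (hprod m le_rfl x hx)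

/-- If `W_k = U₀ ⊔ ⋯ ⊔ U_k` with independent summands for every `k`, then each `U i` is a
complement of the previous step of the filtration. -/
theorem disjoint_and_sup_eq_of_splitting {α : Type*} [CompleteLattice α] {n : ℕ} {W : ℕ → α}
    (hbot : W 0 = ⊥) {U : Fin (n + 1) → α}
    (hU : ∀ k : Fin (n + 1),
      iSupIndep (fun i : Fin ((k : ℕ) + 1) => U (Fin.castLE k.isLt i)) ∧
        W ((k : ℕ) + 1) = ⨆ i : Fin ((k : ℕ) + 1), U (Fin.castLE k.isLt i))
    (i : Fin (n + 1)) : Disjoint (U i) (W i) ∧ W i ⊔ U i = W (i + 1) := by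
  have hW : W i = ⨆ j : Fin i, U (Fin.castLE i.isLt j.castSucc) := by
    obtain ⟨_ | k, hk⟩ := i
    · exact hbot.trans (iSup_of_empty _).symm
    · exact (hU ⟨k, by lia⟩).2
  refine ⟨((hU i).1 (Fin.last i)).mono_right ?_, ?_⟩
  · rw [hW]
    exact iSup_le fun j => le_iSup₂_of_le j.castSucc j.castSucc_lt_last.ne le_rfl
  · rw [hW, (hU i).2]
    refine le_antisymm (sup_le (iSup_le fun j => ?_) ?_) (iSup_le fun j => ?_)
    · exact le_iSup (fun j : Fin ((i : ℕ) + 1) => U (Fin.castLE i.isLt j)) j.castSucc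
    · exact le_iSup (fun j : Fin ((i : ℕ) + 1) => U (Fin.castLE i.isLt j)) (Fin.last i)
    · induction j using Fin.lastCases with
      | last => exact le_sup_right
      | cast j =>
        exact le_sup_of_le_left
          (le_iSup (fun j : Fin i => U (Fin.castLE i.isLt j.castSucc)) j)

/-- A filtration `⊥ = W₋₁ ≤ W₀ ≤ ⋯ ≤ Wₙ = ⊤` by `φ`-invariant subspaces (here encoded with an
index shift, so that `W k` denotes `W_{k-1}`) whose graded characteristic polynomials are
pairwise coprime splits canonically: there is a unique family `U₀, …, Uₙ` of `φ`-invariant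
subspaces such that for every `k` the subspaces `U₀, …, U_k` are independent with
`W_k = U₀ ⊔ ⋯ ⊔ U_k`. -/
theorem unique_invariant_splitting_of_filtration
    {L V : Type*} [Field L] [AddCommGroup V] [Module L V] [FiniteDimensional L V]
    (φ : V →ₗ[L] V) (n : ℕ) (W : ℕ → Submodule L V)
    (hbot : W 0 = ⊥) (htop : W (n + 1) = ⊤) (hmono : Monotone W)
    (hinv : ∀ k, ∀ x ∈ W k, φ x ∈ W k)
    (P : ℕ → Polynomial L)
    (hP : ∀ k ≤ n, P k = gradedCharpoly φ (W k) (W (k + 1)) (hinv k) (hinv (k + 1)))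
    (hcop : ∀ k ≤ n, ∀ j ≤ n, k ≠ j → IsCoprime (P k) (P j)) :
    ∃! U : Fin (n + 1) → Submodule L V,
      (∀ i, ∀ x ∈ U i, φ x ∈ U i) ∧
      ∀ k : Fin (n + 1),
        iSupIndep (fun i : Fin ((k : ℕ) + 1) => U (Fin.castLE k.isLt i)) ∧
        W ((k : ℕ) + 1) = ⨆ i : Fin ((k : ℕ) + 1), U (Fin.castLE k.isLt i) := by
  have hW : ∀ k ≤ n, ∀ x ∈ W (k + 1), Polynomial.aeval φ (P k) x ∈ W k := fun k hk x hx => by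
    rw [hP k hk]
    exact aeval_gradedCharpoly_apply_mem _ _ hx
  have hstep : ∀ i ≤ n, ∀ m ≤ n, i ≠ m → ∀ x, Polynomial.aeval φ (P i) x = 0 →
      x ∈ W (m + 1) → x ∈ W m := fun i hi m hm him x hx hxm =>
    mem_of_aeval_apply_eq_zero_of_isCoprime (hinv m) (hcop i hi m hm him) hx (hW m hm x hxm)
  have hupper : ∀ i ≤ n, LinearMap.ker (Polynomial.aeval φ (P i)) ≤ W (i + 1) := by
    intro i hi x hx
    have hdesc : ∀ m ≤ n + 1, i + 1 ≤ m → x ∈ W m := fun m hm him => by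
      induction hm using Nat.decreasingInduction with
      | self => simp [htop]
      | of_succ m hm ih => exact hstep i hi m (by lia) (by lia) x hx (ih (by lia))
    exact hdesc (i + 1) (by lia) le_rfl
  have hlower : ∀ i ≤ n, Disjoint (LinearMap.ker (Polynomial.aeval φ (P i))) (W i) := by
    intro i hi
    rw [Submodule.disjoint_def]
    intro x hx hxi
    have hdesc : ∀ m ≤ i, x ∈ W m := fun m hm => by
      induction hm using Nat.decreasingInduction with
      | self => exact hxi
      | of_succ m hm ih => exact hstep i hi m (by lia) (by lia) x hx ih
    simpa [hbot] using hdesc 0 (Nat.zero_le i)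
  refine ⟨fun i => LinearMap.ker (Polynomial.aeval φ (P i)), ⟨fun i x hx => ?_, fun k => ⟨?_, ?_⟩⟩,
    fun U hU => funext fun i => ?_⟩
  · rw [LinearMap.mem_ker] at hx ⊢
    rw [← aeval_comp_of_comp_eq (f := φ) (fun _ => rfl), hx, map_zero]
  · refine iSupIndep_ker_aeval_of_pairwise_isCoprime φ fun i j hij => ?_
    exact hcop _ (by simp; lia) _ (by simp; lia) (by simpa [Fin.ext_iff] using hij)
  · refine le_antisymm ?_ (iSup_le fun i => ?_)
    · exact le_iSup_ker_aeval_of_filtration hbot _ (fun j hj => hW j (by lia))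
        fun j hj l hl => hcop j (by lia) l (by lia)
    · exact (hupper i (by lia)).trans (hmono (by lia))
  · have hi : (i : ℕ) ≤ n := by lia
    obtain ⟨hdisj, hsup⟩ := disjoint_and_sup_eq_of_splitting hbot hU.2 i
    have hle : U i ≤ LinearMap.ker (Polynomial.aeval φ (P i)) := fun x hx =>
      Submodule.disjoint_def.mp hdisj _
        (Polynomial.aeval_apply_mem_of_invariant (hU.1 i) (P i) x hx)
        (hW i hi x (hsup ▸ Submodule.mem_sup_right hx))
    refine le_antisymm hle fun x hx => ?_
    obtain ⟨w, hw, u, hu, rfl⟩ := Submodule.mem_sup.mp (hsup ▸ hupper i hi hx)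
    have hw0 : w = 0 := Submodule.disjoint_def.mp (hlower i hi) w
      (by simpa using Submodule.sub_mem _ hx (hle hu)) hw
    simpa [hw0] using hu
end

section
/- Let L be a field, V a finite-dimensional L-vector space, φ : V → V an L-linear endomorphism, and ⊥ = W_{-1} ≤ W_0 ≤ W_1 ≤ ⋯ ≤ W_n = ⊤ a chain of φ-invariant subspaces. Let P_i ∈ L[X] be the characteristic polynomial of the endomorphism induced by φ on W_i/W_{i-1}, and assume the P_i are pairwise coprime in L[X]. Then for every k one has W_k = ⨆_{i ≤ k} ker(P_i(φ)), where P_i(φ) denotes the evaluation (aeval φ P_i), and the subspaces ker(P_0(φ)), …, ker(P_n(φ)) are independent. Consequently, every L-linear endomorphism g of V with g ∘ φ = φ ∘ g maps each ker(P_i(φ)) into itself, so the canonical splitting of the filtration is preserved by every operator commuting with φ. -/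
open Polynomial in
theorem mem_of_aeval_mem_invariant {L V : Type*} [Field L] [AddCommGroup V] [Module L V]
    (φ : V →ₗ[L] V) (W : Submodule L V) (hW : ∀ x ∈ W, φ x ∈ W) (p : L[X]) {v : V}
    (hv : v ∈ W) : aeval φ p v ∈ W := by
  induction p using Polynomial.induction_on' with
  | add p q hp hq => simpa using W.add_mem hp hq
  | monomial m a =>
    rw [aeval_monomial, ← Algebra.smul_def, LinearMap.smul_apply]
    refine W.smul_mem _ ?_
    induction m with
    | zero => simpa using hv
    | succ m ih => simpa [pow_succ'] using hW _ ih

open Polynomial in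
theorem aeval_gradedEnd_mk {L V : Type*} [Field L] [AddCommGroup V] [Module L V]
    (φ : V →ₗ[L] V) (A B : Submodule L V)
    (hA : ∀ x ∈ A, φ x ∈ A) (hB : ∀ x ∈ B, φ x ∈ B) (p : L[X]) (v : B) :
    aeval (gradedEnd φ A B hA hB) p (Submodule.Quotient.mk v) =
      Submodule.Quotient.mk ⟨aeval φ p v, mem_of_aeval_mem_invariant φ B hB p v.2⟩ := by
  induction p using Polynomial.induction_on' with
  | add p q hp hq =>
    simp only [map_add, LinearMap.add_apply, hp, hq]
    rfl
  | monomial m a =>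
    simp only [aeval_monomial, ← Algebra.smul_def, LinearMap.smul_apply]
    have h : ∀ m : ℕ, ∃ h : (φ ^ m) (v : V) ∈ B,
        (gradedEnd φ A B hA hB ^ m) (Submodule.Quotient.mk v) =
          Submodule.Quotient.mk ⟨(φ ^ m) v, h⟩ := by
      intro m
      induction m with
      | zero => exact ⟨v.2, rfl⟩
      | succ m ih =>
        obtain ⟨h, e⟩ := ih
        refine ⟨by simpa [pow_succ'] using hB _ h, ?_⟩
        rw [pow_succ', Module.End.mul_apply, e]
        simp only [pow_succ', Module.End.mul_apply]
        rfl
    obtain ⟨h, e⟩ := h m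
    rw [e]
    rfl

/-- Cayley-Hamilton on a graded piece. -/
theorem aeval_gradedCharpoly_mem {L V : Type*} [Field L] [AddCommGroup V] [Module L V]
    [FiniteDimensional L V] (φ : V →ₗ[L] V) (A B : Submodule L V)
    (hA : ∀ x ∈ A, φ x ∈ A) (hB : ∀ x ∈ B, φ x ∈ B) {v : V} (hv : v ∈ B) :
    Polynomial.aeval φ (gradedCharpoly φ A B hA hB) v ∈ A := by
  have h := aeval_gradedEnd_mk φ A B hA hB (gradedCharpoly φ A B hA hB) ⟨v, hv⟩
  rw [gradedCharpoly, LinearMap.aeval_self_charpoly, LinearMap.zero_apply, eq_comm,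
    Submodule.Quotient.mk_eq_zero] at h
  exact h

theorem Polynomial.ker_aeval_le_of_dvd {L V : Type*} [Field L] [AddCommGroup V] [Module L V]
    (φ : V →ₗ[L] V) {p q : Polynomial L} (h : p ∣ q) :
    LinearMap.ker (aeval φ p) ≤ LinearMap.ker (aeval φ q) := by
  obtain ⟨r, rfl⟩ := h
  exact le_sup_left.trans sup_ker_aeval_le_ker_aeval_mul

theorem Polynomial.iSupIndep_ker_aeval {L V ι : Type*} [Field L] [AddCommGroup V] [Module L V]
    [Fintype ι] (φ : V →ₗ[L] V) (P : ι → Polynomial L)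
    (h : Pairwise fun i j => IsCoprime (P i) (P j)) :
    iSupIndep fun i => LinearMap.ker (aeval φ (P i)) := by
  classical
  intro i
  refine (disjoint_ker_aeval_of_isCoprime φ
    (q := ∏ j ∈ Finset.univ.erase i, P j) (IsCoprime.prod_right fun j hj => ?_)).mono_right ?_
  · exact h (Finset.ne_of_mem_erase hj).symm
  · exact iSup₂_le fun j hj =>
      ker_aeval_le_of_dvd φ (Finset.dvd_prod_of_mem P (by simpa using hj))

theorem Polynomial.ker_aeval_prod_le_iSup {L V ι : Type*} [Field L] [AddCommGroup V]
    [Module L V] (φ : V →ₗ[L] V) (P : ι → Polynomial L) (s : Finset ι)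
    (h : (s : Set ι).Pairwise fun i j => IsCoprime (P i) (P j)) :
    LinearMap.ker (aeval φ (∏ i ∈ s, P i)) ≤ ⨆ i ∈ s, LinearMap.ker (aeval φ (P i)) := by
  classical
  induction s using Finset.induction_on with
  | empty => intro v hv; simpa using hv
  | insert a s ha ih =>
    rw [Finset.prod_insert ha, ← sup_ker_aeval_eq_ker_aeval_mul_of_coprime, Finset.iSup_insert]
    · exact sup_le_sup_left (ih (h.mono (by simp))) _
    · refine IsCoprime.prod_right fun j hj => h (by simp) (by simp [hj]) ?_
      rintro rfl
      exact ha hj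

/-- For a filtration `⊥ = W₋₁ ≤ W₀ ≤ ⋯ ≤ Wₙ = ⊤` by `φ`-invariant subspaces (encoded with an
index shift, so that `W k` denotes `W_{k-1}`) whose graded characteristic polynomials `P i` are
pairwise coprime, one has `W_k = ⨆_{i ≤ k} ker (P i (φ))`, the kernels `ker (P i (φ))` are
independent, and every operator commuting with `φ` preserves each `ker (P i (φ))`. -/
theorem filtration_eq_sup_kernels_and_equivariant_splitting
    {L V : Type*} [Field L] [AddCommGroup V] [Module L V] [FiniteDimensional L V]
    (φ : V →ₗ[L] V) (n : ℕ) (W : ℕ → Submodule L V)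
    (hbot : W 0 = ⊥) (htop : W (n + 1) = ⊤) (hmono : Monotone W)
    (hinv : ∀ k, ∀ x ∈ W k, φ x ∈ W k)
    (P : ℕ → Polynomial L)
    (hP : ∀ k ≤ n, P k = gradedCharpoly φ (W k) (W (k + 1)) (hinv k) (hinv (k + 1)))
    (hcop : ∀ k ≤ n, ∀ j ≤ n, k ≠ j → IsCoprime (P k) (P j)) :
    (∀ k ≤ n, W (k + 1) = ⨆ i ≤ k, LinearMap.ker (Polynomial.aeval φ (P i))) ∧
    iSupIndep (fun i : Fin (n + 1) => LinearMap.ker (Polynomial.aeval φ (P (i : ℕ)))) ∧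
    (∀ g : V →ₗ[L] V, g ∘ₗ φ = φ ∘ₗ g → ∀ i ≤ n,
      (LinearMap.ker (Polynomial.aeval φ (P i))).map g ≤
        LinearMap.ker (Polynomial.aeval φ (P i))) := by
  have hstep : ∀ k ≤ n, ∀ v ∈ W (k + 1), Polynomial.aeval φ (P k) v ∈ W k := by
    intro k hk v hv
    rw [hP k hk]
    exact aeval_gradedCharpoly_mem φ _ _ _ _ hv
  have hker : ∀ i ≤ n, LinearMap.ker (Polynomial.aeval φ (P i)) ≤ W (i + 1) := by
    intro i hi v hv
    refine Nat.decreasingInduction' (m := i + 1) (n := n + 1) (P := fun j => v ∈ W j)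
      (fun j hj hij hmem => ?_) (by omega) (by simp [htop])
    obtain ⟨a, b, hab⟩ := hcop i hi j (by omega) (by omega)
    have hv' : v = Polynomial.aeval φ b (Polynomial.aeval φ (P j) v) := by
      have h := congrArg (fun p => Polynomial.aeval φ p v) hab
      simpa [LinearMap.mem_ker.mp hv] using h.symm
    rw [hv']
    exact mem_of_aeval_mem_invariant φ _ (hinv j) b (hstep j (by omega) v hmem)
  have hprod : ∀ k ≤ n + 1, W k ≤
      LinearMap.ker (Polynomial.aeval φ (∏ i ∈ Finset.range k, P i)) := by
    intro k
    induction k with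
    | zero => simp [hbot]
    | succ k ih =>
      intro hk v hv
      rw [Finset.prod_range_succ, LinearMap.mem_ker, map_mul, Module.End.mul_apply]
      exact ih (by omega) (hstep k (by omega) v hv)
  refine ⟨fun k hk => le_antisymm ?_ ?_, ?_, ?_⟩
  · refine (hprod (k + 1) (by omega)).trans
      ((Polynomial.ker_aeval_prod_le_iSup φ P _ ?_).trans ?_)
    · intro i hi j hj hij
      simp only [Finset.coe_range, Set.mem_Iio] at hi hj
      exact hcop i (by omega) j (by omega) hij
    · simp
  · exact iSup₂_le fun i hi => (hker i (by omega)).trans (hmono (by omega))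
  · exact Polynomial.iSupIndep_ker_aeval φ (fun i : Fin (n + 1) => P i) fun i j hij =>
      hcop i (by omega) j (by omega) (Fin.val_ne_of_ne hij)
  · rintro g hg i - _ ⟨v, hv, rfl⟩
    have hc : Commute g (Polynomial.aeval φ (P i)) :=
      Algebra.commute_of_mem_adjoin_singleton_of_commute (R := L)
        (Polynomial.aeval_mem_adjoin_singleton L φ) hg
    have h := LinearMap.congr_fun hc.eq v
    rw [Module.End.mul_apply, Module.End.mul_apply, LinearMap.mem_ker.mp hv, map_zero] at h
    exact h.symm
end
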